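/- Suppose X has the Δ-property and |X| ≥ d+2. Then every τ ∈ Incr(γ) is either (i) contained in σ ∪ {x,y} for some conflict triple (σ,x,y), or (ii) contained in σ ∪ {x} for some conflict pair (σ,x) such that T_σ = {x}. -/

import Mathlib

noncomputable section

attribute [local instance] Classical.propDecidable

/-- Euclidean space ℝ^d. -/
abbrev Pt (d : ℕ) := EuclideanSpace ℝ (Fin d)

variable {d : ℕ}

/-- The sphere with center `c` and radius `r` is a circumsphere of the finite set `Q`:
every point of `Q` lies on it. -/
def OnSphere (c : Pt d) (r : ℝ) (Q : Finset (Pt d)) : Prop :=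
  ∀ w ∈ Q, ‖w - c‖ = r

/-- The sphere with center `c` and radius `r` is `Z`-empty: no point of `Z` lies inside it. -/
def SphEmpty (c : Pt d) (r : ℝ) (Z : Finset (Pt d)) : Prop :=
  ∀ z ∈ Z, ¬ ‖z - c‖ < r

/-- The Delaunay triangulation of `Z`: nonempty subsets of `Z` admitting a `Z`-empty
circumsphere. -/
def DelT (Z : Finset (Pt d)) : Set (Finset (Pt d)) :=
  {σ | σ.Nonempty ∧ σ ⊆ Z ∧ ∃ c r, 0 ≤ r ∧ OnSphere c r σ ∧ SphEmpty c r Z}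

/-- `Z` is in general position: every nonempty subset `Q` of at most `d+1` points is affinely
independent, and no point of `Z \ Q` lies on the smallest circumsphere of `Q`. -/
def GenPos (Z : Finset (Pt d)) : Prop :=
  ∀ Q : Finset (Pt d), Q ⊆ Z → Q.Nonempty → Q.card ≤ d + 1 →
    (AffineIndependent ℝ (fun q : ↥(Q : Set (Pt d)) => (q : Pt d))) ∧
    ∀ c r, 0 ≤ r → OnSphere c r Q →
      (∀ c' r', 0 ≤ r' → OnSphere c' r' Q → r ≤ r') →
      ∀ z ∈ Z, z ∉ Q → ‖z - c‖ ≠ r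

/-- The sublevel set `X_p = {x ∈ X : γ(x) ≤ p}` (product order on `ℝ²`). -/
def Xsub (X : Finset (Pt d)) (γ : Pt d → ℝ × ℝ) (p : ℝ × ℝ) : Finset (Pt d) :=
  X.filter fun z => γ z ≤ p

/-- `x` is the point of `σ` with largest `γ₁`-value. -/
def IsMax1 (γ : Pt d → ℝ × ℝ) (σ : Finset (Pt d)) (x : Pt d) : Prop :=
  x ∈ σ ∧ ∀ z ∈ σ, (γ z).1 ≤ (γ x).1

/-- `y` is the point of `σ` with largest `γ₂`-value. -/
def IsMax2 (γ : Pt d → ℝ × ℝ) (σ : Finset (Pt d)) (y : Pt d) : Prop :=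
  y ∈ σ ∧ ∀ z ∈ σ, (γ z).2 ≤ (γ y).2

/-- The sphere of center `c` and radius `r` is a witness of `σ`, where `x = max₁(σ)` and
`y = max₂(σ)`: it is a circumsphere of `σ \ {x,y}`, `x` and `y` lie inside or on it, and it is
`(X_{γ(σ)} \ {x,y})`-empty (note `γ(σ) = (γ₁ x, γ₂ y)`). -/
def IsWitness (X : Finset (Pt d)) (γ : Pt d → ℝ × ℝ) (σ : Finset (Pt d))
    (x y c : Pt d) (r : ℝ) : Prop :=
  (∀ z ∈ σ, z ≠ x → z ≠ y → ‖z - c‖ = r) ∧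
  ‖x - c‖ ≤ r ∧ ‖y - c‖ ≤ r ∧
  ∀ w ∈ Xsub X γ ((γ x).1, (γ y).2), w ≠ x → w ≠ y → ¬ ‖w - c‖ < r

/-- The incremental Delaunay complex `Incr(γ)`: nonempty subsets of `X` admitting a witness. -/
def Incr (X : Finset (Pt d)) (γ : Pt d → ℝ × ℝ) : Set (Finset (Pt d)) :=
  {σ | σ.Nonempty ∧ σ ⊆ X ∧
    ∃ x y c r, IsMax1 γ σ x ∧ IsMax2 γ σ y ∧ 0 ≤ r ∧ IsWitness X γ σ x y c r}

/-- The incremental Delaunay radius `ω_σ`: the minimum radius of a witness of `σ`. -/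
def omegaRad (X : Finset (Pt d)) (γ : Pt d → ℝ × ℝ) (σ : Finset (Pt d)) : ℝ :=
  sInf {r | 0 ≤ r ∧ ∃ x y c, IsMax1 γ σ x ∧ IsMax2 γ σ y ∧ IsWitness X γ σ x y c r}

/-- `γ(σ)`: the coordinatewise maximum of `γ` over the nonempty finite set `σ`. -/
def gammaJoin (γ : Pt d → ℝ × ℝ) (σ : Finset (Pt d)) (h : σ.Nonempty) : ℝ × ℝ :=
  (σ.sup' h fun z => (γ z).1, σ.sup' h fun z => (γ z).2)

/-- `(σ, x)` is a conflict pair at `p ∈ Grid(γ)`: `σ` is a `d`-simplex of `DelT(X_p)`, `x` lies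
inside the circumsphere of `σ`, and either `p₁ < max(im γ₁)` and `x ∈ X_{p→}`, or
`p₂ < max(im γ₂)` and `x ∈ X_{p↑}` (the successor being expressed by its defining property). -/
def ConflictAt (X : Finset (Pt d)) (γ : Pt d → ℝ × ℝ) (p : ℝ × ℝ)
    (σ : Finset (Pt d)) (x : Pt d) : Prop :=
  p.1 ∈ X.image (fun z => (γ z).1) ∧ p.2 ∈ X.image (fun z => (γ z).2) ∧
  σ ∈ DelT (Xsub X γ p) ∧ σ.card = d + 1 ∧
  (∃ c r, 0 ≤ r ∧ OnSphere c r σ ∧ ‖x - c‖ < r) ∧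
  ((∃ a ∈ X.image (fun z => (γ z).1), p.1 < a ∧
      (∀ b ∈ X.image (fun z => (γ z).1), p.1 < b → a ≤ b) ∧
      x ∈ Xsub X γ (a, p.2)) ∨
   (∃ a ∈ X.image (fun z => (γ z).2), p.2 < a ∧
      (∀ b ∈ X.image (fun z => (γ z).2), p.2 < b → a ≤ b) ∧
      x ∈ Xsub X γ (p.1, a)))

/-- `(σ, x)` is a conflict pair: it is a conflict pair at some `p ∈ Grid(γ)`. -/
def ConflictPair (X : Finset (Pt d)) (γ : Pt d → ℝ × ℝ)
    (σ : Finset (Pt d)) (x : Pt d) : Prop :=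
  ∃ p, ConflictAt X γ p σ x

/-- `Δ` witnesses the Δ-property of `X`: `Δ` consists of `d+1` points of `X` which come first in
both the `γ₁`- and `γ₂`-orders, the two orders agree on `Δ`, and `X` is contained in the convex
hull of `Δ`. -/
def IsDelta (X : Finset (Pt d)) (γ : Pt d → ℝ × ℝ) (Δ : Finset (Pt d)) : Prop :=
  Δ ⊆ X ∧ Δ.card = d + 1 ∧
  (∀ a ∈ Δ, ∀ b ∈ X, b ∉ Δ → (γ a).1 < (γ b).1 ∧ (γ a).2 < (γ b).2) ∧
  (∀ a ∈ Δ, ∀ b ∈ Δ, ((γ a).1 ≤ (γ b).1 ↔ (γ a).2 ≤ (γ b).2)) ∧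
  (↑X : Set (Pt d)) ⊆ convexHull ℝ (↑Δ : Set (Pt d))

/-- The Voronoi cell of `x` with respect to `Y`. -/
def VorCell (x : Pt d) (Y : Set (Pt d)) : Set (Pt d) :=
  {w | ∀ y ∈ Y, ‖w - x‖ ≤ ‖w - y‖}

/-- The telescopic Voronoi cell `Tel(x)`: the closure of `⋃_{q ≥ γ(x)} Vor(x, X_q) × {q}`. -/
def Tel (X : Finset (Pt d)) (γ : Pt d → ℝ × ℝ) (x : Pt d) : Set (Pt d × (ℝ × ℝ)) :=
  closure {z | γ x ≤ z.2 ∧ z.1 ∈ VorCell x (↑(Xsub X γ z.2) : Set (Pt d))}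

/-- The telescopic Voronoi ball `TelVor(x)_{p,r}`. -/
def TelVor (X : Finset (Pt d)) (γ : Pt d → ℝ × ℝ) (x : Pt d) (p : ℝ × ℝ) (r : ℝ) :
    Set (Pt d × (ℝ × ℝ)) :=
  Tel X γ x ∩ {z | z.1 ∈ Metric.closedBall x r ∧ z.2 ≤ p}

/-- The telescopic Voronoi cell `TelVor(x)_{p,∞}`. -/
def TelVorInf (X : Finset (Pt d)) (γ : Pt d → ℝ × ℝ) (x : Pt d) (p : ℝ × ℝ) :
    Set (Pt d × (ℝ × ℝ)) :=
  Tel X γ x ∩ {z | z.2 ≤ p}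

/-- The radius of the smallest enclosing ball of `σ`. -/
def miniballRadius (σ : Finset (Pt d)) : ℝ :=
  sInf {r | 0 ≤ r ∧ ∃ c : Pt d, ∀ x ∈ σ, ‖x - c‖ ≤ r}

/-- The Delaunay radius `b_σ`: the minimum radius of a `Z`-empty circumsphere of `σ`. -/
def delRad (Z σ : Finset (Pt d)) : ℝ :=
  sInf {r | 0 ≤ r ∧ ∃ c, OnSphere c r σ ∧ SphEmpty c r Z}

/-- The telescopic offset `TelOffset_{p,r} ⊆ ℝ^d × ℝ²`. -/
def TelOffsetSet (X : Finset (Pt d)) (γ : Pt d → ℝ × ℝ) (p : ℝ × ℝ) (r : ℝ) :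
    Set (Pt d × (ℝ × ℝ)) :=
  ⋃ x ∈ X, Metric.closedBall x r ×ˢ {q : ℝ × ℝ | γ x ≤ q ∧ q ≤ p}

/-- The sublevel offset `Offset_{p,r} ⊆ ℝ^d`. -/
def OffsetSet (X : Finset (Pt d)) (γ : Pt d → ℝ × ℝ) (p : ℝ × ℝ) (r : ℝ) : Set (Pt d) :=
  ⋃ x ∈ Xsub X γ p, Metric.closedBall x r

/-- `OU_r = ⋃_{x ∈ X} Ball_r(x) × Vor(x,X) ⊆ ℝ^d × ℝ^d`. -/
def OUSet (X : Finset (Pt d)) (r : ℝ) : Set (Pt d × Pt d) :=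
  ⋃ x ∈ X, Metric.closedBall x r ×ˢ VorCell x (↑X : Set (Pt d))

/-- `Offset(X)_r = ⋃_{x ∈ X} Ball_r(x) ⊆ ℝ^d`. -/
def OffsetR (X : Finset (Pt d)) (r : ℝ) : Set (Pt d) :=
  ⋃ x ∈ X, Metric.closedBall x r

/-- `OTelDC_{p,r} ⊆ ℝ^d × ℝ^d × ℝ²`. -/
def OTelDCSet (X : Finset (Pt d)) (γ : Pt d → ℝ × ℝ) (p : ℝ × ℝ) (r : ℝ) :
    Set (Pt d × Pt d × (ℝ × ℝ)) :=
  {z | z.2.2 ≤ p ∧ ∃ x ∈ Xsub X γ z.2.2,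
    ‖x - z.1‖ ≤ r ∧ z.2.1 ∈ VorCell x (↑(Xsub X γ z.2.2) : Set (Pt d))}

/-- The power of `w` with respect to the sphere centered at `c` whose squared radius is
`k + ‖c‖ ^ 2`. -/
def spherePower (c : Pt d) (k : ℝ) (w : Pt d) : ℝ :=
  ‖w‖ ^ 2 - 2 * inner ℝ c w - k

lemma spherePower_sub_norm_sq (c : Pt d) (ρ : ℝ) (w : Pt d) :
    spherePower c (ρ - ‖c‖ ^ 2) w = ‖w - c‖ ^ 2 - ρ := by
  rw [spherePower, norm_sub_sq_real, real_inner_comm]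
  ring

/-- An affine function vanishing on an affinely spanning set is zero. -/
lemma affine_eq_zero_of_span {Q : Set (Pt d)} (hQ : affineSpan ℝ Q = ⊤) (u : Pt d) (l : ℝ)
    (h : ∀ w ∈ Q, inner ℝ u w + l = 0) : u = 0 ∧ l = 0 := by
  have key : ∀ w : Pt d, inner ℝ u w + l = 0 := by
    intro w
    have hw : w ∈ affineSpan ℝ Q := by rw [hQ]; trivial
    refine affineSpan_induction (p := fun w => inner ℝ u w + l = 0) hw h ?_
    intro t a b e ha hb he
    simp only [vsub_eq_sub, vadd_eq_add, inner_add_right, inner_smul_right, inner_sub_right]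
    linear_combination t * ha - t * hb + he
  have hl : l = 0 := by simpa using key 0
  have hu : inner ℝ u u + l = 0 := key u
  rw [hl, add_zero, inner_self_eq_zero] at hu
  exact ⟨hu, hl⟩

lemma GenPos.affineSpan_eq_top {X Q : Finset (Pt d)} (hgen : GenPos X) (hQ : Q ⊆ X)
    (hcard : Q.card = d + 1) : affineSpan ℝ (Q : Set (Pt d)) = ⊤ := by
  have hne : Q.Nonempty := Finset.card_pos.mp (by omega)
  have hind := (hgen Q hQ hne hcard.le).1
  have := hind.affineSpan_eq_top_iff_card_eq_finrank_add_one.mpr (by simpa using hcard)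
  simpa using this

lemma onSphere_unique {Q : Finset (Pt d)} (hne : Q.Nonempty)
    (hspan : affineSpan ℝ (Q : Set (Pt d)) = ⊤)
    {c c' : Pt d} {r r' : ℝ} (h : OnSphere c r Q) (h' : OnSphere c' r' Q) :
    c = c' ∧ r = r' := by
  have key := affine_eq_zero_of_span hspan ((2 : ℝ) • (c' - c))
    (r' ^ 2 - ‖c'‖ ^ 2 - (r ^ 2 - ‖c‖ ^ 2)) (fun w hw => by
      have e1 := norm_sub_sq_real w c
      have e2 := norm_sub_sq_real w c'
      rw [h w hw] at e1
      rw [h' w hw] at e2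
      rw [two_smul, inner_add_left, inner_sub_left, real_inner_comm w c, real_inner_comm w c']
      linarith)
  have hc : c = c' := by
    have := (smul_eq_zero.mp key.1).resolve_left two_ne_zero
    exact (sub_eq_zero.mp this).symm
  obtain ⟨w, hw⟩ := hne
  refine ⟨hc, ?_⟩
  rw [← h w hw, ← h' w hw, hc]

/-- In general position, a sphere carries at most `d + 1` points. -/
lemma GenPos.card_le_of_onSphere {X S : Finset (Pt d)} (hgen : GenPos X) (hS : S ⊆ X)
    {c : Pt d} {r : ℝ} (hr : 0 ≤ r) (h : OnSphere c r S) : S.card ≤ d + 1 := by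
  by_contra! hlt
  obtain ⟨Q, hQS, hQ⟩ := Finset.exists_subset_card_eq hlt.le
  obtain ⟨z, hzS, hzQ⟩ := Finset.exists_mem_notMem_of_card_lt_card (hQ.trans_lt hlt)
  have hne : Q.Nonempty := Finset.card_pos.mp (by omega)
  have hQX := hQS.trans hS
  have hon : OnSphere c r Q := fun w hw => h w (hQS hw)
  refine (hgen Q hQX hne hQ.le).2 c r hr hon ?_ z (hS hzS) hzQ (h z hzS)
  intro c' r' _ h'
  exact (onSphere_unique hne (hgen.affineSpan_eq_top hQX hQ) hon h').2.le

/-- A set of at most `d` points is contained in the zero set of a nonzero affine function. -/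
lemma exists_affine_vanishing (S : Finset (Pt d)) (hS : S.card < d + 1) :
    ∃ (u : Pt d) (l : ℝ), (u, l) ≠ 0 ∧ ∀ w ∈ S, inner ℝ u w + l = 0 := by
  let φ : (Pt d × ℝ) →ₗ[ℝ] (S → ℝ) := LinearMap.pi fun w =>
    (innerₗ (Pt d) (w : Pt d)).comp (LinearMap.fst ℝ (Pt d) ℝ) + LinearMap.snd ℝ (Pt d) ℝ
  have hker : LinearMap.ker φ ≠ ⊥ := LinearMap.ker_ne_bot_of_finrank_lt (by simpa using hS)
  obtain ⟨⟨u, l⟩, hmem, hne⟩ := Submodule.exists_mem_ne_zero_of_ne_bot hker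
  refine ⟨u, l, hne, fun w hw => ?_⟩
  have := congrFun (LinearMap.mem_ker.mp hmem) ⟨w, hw⟩
  simpa [φ, real_inner_comm] using this

/-- A nonzero affine function can be oriented to be nonnegative at a given point of the convex
hull of a spanning set and positive somewhere on that set. -/
lemma exists_affine_oriented {Δ : Finset (Pt d)} (hspan : affineSpan ℝ (Δ : Set (Pt d)) = ⊤)
    {x : Pt d} (hx : x ∈ convexHull ℝ (Δ : Set (Pt d))) {u : Pt d} {l : ℝ} (hne : (u, l) ≠ 0) :
    ∃ s : ℝ, 0 ≤ s * (inner ℝ u x + l) ∧ ∃ w ∈ Δ, 0 < s * (inner ℝ u w + l) := by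
  have hpos : ∀ s : ℝ, 0 < s * (inner ℝ u x + l) → ∃ w ∈ Δ, 0 < s * (inner ℝ u w + l) := by
    intro s hs
    by_contra! hle
    have hconv : Convex ℝ {w : Pt d | s * (inner ℝ u w + l) ≤ 0} := by
      intro a ha b hb α β hα hβ hαβ
      simp only [Set.mem_ofPred_eq, inner_add_right, inner_smul_right] at ha hb ⊢
      have hβ' : β = 1 - α := by linarith
      subst hβ'
      nlinarith [mul_nonneg hα (neg_nonneg.mpr ha), mul_nonneg hβ (neg_nonneg.mpr hb)]
    exact absurd (convexHull_min hle hconv hx) (not_le.mpr hs)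
  rcases lt_trichotomy (inner ℝ u x + l) 0 with h | h | h
  · exact ⟨-1, by linarith, hpos (-1) (by linarith)⟩
  · have : ∃ w ∈ Δ, inner ℝ u w + l ≠ 0 := by
      by_contra! hz
      obtain ⟨rfl, rfl⟩ := affine_eq_zero_of_span hspan u l hz
      exact hne rfl
    obtain ⟨w, hw, hw0⟩ := this
    rcases lt_or_gt_of_ne hw0 with hlt | hgt
    · exact ⟨-1, by simp [h], w, hw, by linarith⟩
    · exact ⟨1, by simp [h], w, hw, by linarith⟩
  · exact ⟨1, by linarith, hpos 1 (by linarith)⟩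

/-- If `g ≥ 0` on a finite set and `h` is positive somewhere on it, then `g - t h` is nonnegative
and attains zero at a point where `h` is positive, for a suitable `t ≥ 0`. -/
lemma exists_first_zero {ι : Type*} (W : Finset ι) (g h : ι → ℝ) (hg : ∀ w ∈ W, 0 ≤ g w)
    (hh : ∃ w ∈ W, 0 < h w) :
    ∃ t : ℝ, 0 ≤ t ∧ (∀ w ∈ W, 0 ≤ g w - t * h w) ∧
      ∃ w ∈ W, 0 < h w ∧ g w - t * h w = 0 := by
  obtain ⟨w₀, hw₀, hw₀'⟩ := hh
  obtain ⟨m, hm, hmin⟩ := Finset.exists_min_image (W.filter fun w => 0 < h w)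
    (fun w => g w / h w) ⟨w₀, by simp [hw₀, hw₀']⟩
  rw [Finset.mem_filter] at hm
  have ht : 0 ≤ g m / h m := div_nonneg (hg m hm.1) hm.2.le
  refine ⟨g m / h m, ht, fun w hw => ?_, m, hm.1, hm.2, ?_⟩
  · by_cases hpos : 0 < h w
    · have := hmin w (Finset.mem_filter.mpr ⟨hw, hpos⟩)
      have := (le_div_iff₀ hpos).mp this
      linarith
    · have := mul_nonneg ht (neg_nonneg.mpr (not_lt.mp hpos))
      have := hg w hw
      linarith
  · rw [div_mul_cancel₀ _ hm.2.ne', sub_self]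

/-- Starting from a sphere with prescribed sides for the points of `W` and with `x` inside or on
it, one reaches such a sphere passing through at least `d + 1` points of `W`, while keeping every
point that already lies on the sphere. -/
lemma exists_spherePower_tight {Δ W : Finset (Pt d)} (hΔW : Δ ⊆ W)
    (hspan : affineSpan ℝ (Δ : Set (Pt d)) = ⊤) {x : Pt d}
    (hx : x ∈ convexHull ℝ (Δ : Set (Pt d))) (e : Pt d → ℝ) (he : ∀ w, e w ≠ 0)
    (heΔ : ∀ w ∈ Δ, e w = 1) (n : ℕ) (c : Pt d) (k : ℝ)
    (hW : ∀ w ∈ W, 0 ≤ e w * spherePower c k w) (hxk : spherePower c k x ≤ 0)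
    (hn : d + 1 ≤ (W.filter fun w => spherePower c k w = 0).card + n) :
    ∃ (c' : Pt d) (k' : ℝ), (∀ w ∈ W, 0 ≤ e w * spherePower c' k' w) ∧
      spherePower c' k' x ≤ 0 ∧ (∀ w ∈ W, spherePower c k w = 0 → spherePower c' k' w = 0) ∧
      d + 1 ≤ (W.filter fun w => spherePower c' k' w = 0).card := by
  induction n generalizing c k with
  | zero => exact ⟨c, k, hW, hxk, fun _ _ h => h, hn⟩
  | succ n ih =>
    by_cases hfull : d + 1 ≤ (W.filter fun w => spherePower c k w = 0).card
    · exact ⟨c, k, hW, hxk, fun _ _ h => h, hfull⟩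
    obtain ⟨u, l, hne, hvan⟩ := exists_affine_vanishing _ (not_le.mp hfull)
    obtain ⟨s, hsx, v, hvΔ, hsv⟩ := exists_affine_oriented hspan hx hne
    obtain ⟨t, ht, hnonneg, m, hmW, hm, hm0⟩ := exists_first_zero W
      (fun w => e w * spherePower c k w) (fun w => e w * (s * (inner ℝ u w + l))) hW
      ⟨v, hΔW hvΔ, by simpa [heΔ v hvΔ] using hsv⟩
    have hpow : ∀ w, spherePower (c + (t * s / 2) • u) (k + t * s * l) w =
        spherePower c k w - t * (s * (inner ℝ u w + l)) := by
      intro w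
      simp only [spherePower, inner_add_left, real_inner_smul_left]
      ring
    have hkeep : ∀ w ∈ W, spherePower c k w = 0 →
        spherePower (c + (t * s / 2) • u) (k + t * s * l) w = 0 := by
      intro w hw h0
      rw [hpow, hvan w (Finset.mem_filter.mpr ⟨hw, h0⟩), h0]
      ring
    have hmz : spherePower (c + (t * s / 2) • u) (k + t * s * l) m = 0 := by
      rw [hpow]
      refine (mul_eq_zero.mp (?_ : e m * _ = 0)).resolve_left (he m)
      linear_combination hm0
    have hmnot : spherePower c k m ≠ 0 := by
      intro h0
      rw [hvan m (Finset.mem_filter.mpr ⟨hmW, h0⟩)] at hm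
      simp at hm
    have hlt : (W.filter fun w => spherePower c k w = 0).card <
        (W.filter fun w =>
          spherePower (c + (t * s / 2) • u) (k + t * s * l) w = 0).card := by
      refine Finset.card_lt_card (Finset.ssubset_iff_of_subset ?_ |>.mpr ⟨m, ?_, ?_⟩)
      · intro w hw
        rw [Finset.mem_filter] at hw ⊢
        exact ⟨hw.1, hkeep w hw.1 hw.2⟩
      · exact Finset.mem_filter.mpr ⟨hmW, hmz⟩
      · exact fun h => hmnot (Finset.mem_filter.mp h).2
    obtain ⟨c', k', h1, h2, h3, h4⟩ := ih (c + (t * s / 2) • u) (k + t * s * l)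
      (fun w hw => by
        rw [hpow]
        have := hnonneg w hw
        linarith)
      (by
        rw [hpow]
        have := mul_nonneg ht hsx
        linarith)
      (by omega)
    exact ⟨c', k', h1, h2, fun w hw h0 => h3 w hw (hkeep w hw h0), h4⟩

/-- A sphere that contains `x` and, if `y ∈ W`, also `y` in its closed ball and is otherwise
`W`-empty can be moved to the circumsphere of `d + 1` points of `W`, keeping the points of `W` on
it, such that `x` and, unless it is one of these `d + 1` points, `y` lie inside. -/
lemma GenPos.exists_circumsphere {X Δ W : Finset (Pt d)} (hgen : GenPos X) (hWX : W ⊆ X)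
    (hΔW : Δ ⊆ W) (hcard : Δ.card = d + 1) {x y : Pt d} (hxX : x ∈ X) (hxW : x ∉ W)
    (hyΔ : y ∉ Δ) (hx : x ∈ convexHull ℝ (Δ : Set (Pt d))) {c : Pt d} {r : ℝ} (hr : 0 ≤ r)
    (hW : ∀ w ∈ W, w ≠ y → r ≤ ‖w - c‖) (hy : y ∈ W → ‖y - c‖ ≤ r) (hxr : ‖x - c‖ ≤ r) :
    ∃ (σ : Finset (Pt d)) (c' : Pt d) (r' : ℝ), 0 ≤ r' ∧ σ ⊆ W ∧ σ.card = d + 1 ∧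
      OnSphere c' r' σ ∧ (∀ w ∈ W, w ≠ y → r' ≤ ‖w - c'‖) ∧
      (y ∈ W → y ∉ σ → ‖y - c'‖ < r') ∧ ‖x - c'‖ < r' ∧ ∀ w ∈ W, ‖w - c‖ = r → w ∈ σ := by
  obtain ⟨c', k', h1, h2, h3, h4⟩ := exists_spherePower_tight hΔW
    (hgen.affineSpan_eq_top (hΔW.trans hWX) hcard) hx (fun w => if w = y then -1 else 1)
    (fun w => by split_ifs <;> norm_num)
    (fun w hw => if_neg (ne_of_mem_of_not_mem hw hyΔ)) (d + 1) c (r ^ 2 - ‖c‖ ^ 2)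
    (fun w hw => by
      rw [spherePower_sub_norm_sq]
      split_ifs with h
      · subst h
        have := pow_le_pow_left₀ (norm_nonneg _) (hy hw) 2
        linarith
      · have := pow_le_pow_left₀ hr (hW w hw h) 2
        linarith)
    (by
      rw [spherePower_sub_norm_sq]
      have := pow_le_pow_left₀ (norm_nonneg _) hxr 2
      linarith)
    (by omega)
  have hk : ∀ w, spherePower c' k' w = ‖w - c'‖ ^ 2 - (k' + ‖c'‖ ^ 2) := fun w => by
    rw [← spherePower_sub_norm_sq, add_sub_cancel_right]
  have hρ : 0 ≤ k' + ‖c'‖ ^ 2 := by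
    have := hk x
    nlinarith [sq_nonneg ‖x - c'‖]
  obtain ⟨r', hr', hr2⟩ : ∃ r' : ℝ, 0 ≤ r' ∧ k' + ‖c'‖ ^ 2 = r' ^ 2 :=
    ⟨_, Real.sqrt_nonneg _, (Real.sq_sqrt hρ).symm⟩
  simp only [hr2] at hk
  have hzero : ∀ w, spherePower c' k' w = 0 ↔ ‖w - c'‖ = r' := fun w => by
    rw [hk, sub_eq_zero, sq_eq_sq₀ (norm_nonneg _) hr']
  set σ := W.filter fun w => spherePower c' k' w = 0
  have hσon : OnSphere c' r' σ := fun w hw => (hzero w).mp (Finset.mem_filter.mp hw).2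
  have hσW : σ ⊆ W := Finset.filter_subset _ _
  have hσcard : σ.card = d + 1 :=
    le_antisymm (hgen.card_le_of_onSphere (hσW.trans hWX) hr' hσon) h4
  refine ⟨σ, c', r', hr', hσW, hσcard, hσon, fun w hw hwy => ?_, fun hyW hyσ => ?_, ?_, ?_⟩
  · have := h1 w hw
    rw [if_neg hwy, one_mul, hk] at this
    exact (sq_le_sq₀ hr' (norm_nonneg _)).mp (by linarith)
  · have := h1 y hyW
    rw [if_pos rfl, hk] at this
    refine lt_of_le_of_ne ((sq_le_sq₀ (norm_nonneg _) hr').mp (by linarith)) fun h => ?_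
    exact hyσ (Finset.mem_filter.mpr ⟨hyW, (hzero y).mpr h⟩)
  · rw [hk] at h2
    refine lt_of_le_of_ne ((sq_le_sq₀ (norm_nonneg _) hr').mp (by linarith)) fun h => ?_
    have hxσ : x ∉ σ := fun h => hxW (hσW h)
    have := hgen.card_le_of_onSphere (S := insert x σ)
      (Finset.insert_subset hxX (hσW.trans hWX)) hr' (fun w hw => by
        rcases Finset.mem_insert.mp hw with rfl | hw
        · exact h
        · exact hσon w hw)
    rw [Finset.card_insert_of_notMem hxσ] at this
    omega
  · intro w hw hwr
    refine Finset.mem_filter.mpr ⟨hw, h3 w hw ?_⟩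
    rw [spherePower_sub_norm_sq, hwr, sub_self]

lemma mem_Xsub {X : Finset (Pt d)} {γ : Pt d → ℝ × ℝ} {p : ℝ × ℝ} {z : Pt d} :
    z ∈ Xsub X γ p ↔ z ∈ X ∧ (γ z).1 ≤ p.1 ∧ (γ z).2 ≤ p.2 := by
  rw [Xsub, Finset.mem_filter, Prod.le_def]

/-- An element of a finite set of reals that is not the least one has a predecessor. -/
lemma exists_predecessor (A : Finset ℝ) {a b : ℝ} (hb : b ∈ A) (hba : b < a) :
    ∃ p ∈ A, p < a ∧ ∀ z ∈ A, p < z → a ≤ z := by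
  obtain ⟨p, hp, hmax⟩ := Finset.exists_max_image (A.filter (· < a)) id
    ⟨b, Finset.mem_filter.mpr ⟨hb, hba⟩⟩
  rw [Finset.mem_filter] at hp
  refine ⟨p, hp.1, hp.2, fun z hz hpz => ?_⟩
  by_contra! hza
  exact absurd (hmax z (Finset.mem_filter.mpr ⟨hz, hza⟩)) (not_le.mpr hpz)

lemma ConflictAt.swap {X : Finset (Pt d)} {γ : Pt d → ℝ × ℝ} {p : ℝ × ℝ}
    {σ : Finset (Pt d)} {x : Pt d} (h : ConflictAt X γ p σ x) :
    ConflictAt X (fun z => (γ z).swap) p.swap σ x := by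
  have hX : ∀ q : ℝ × ℝ, Xsub X (fun z => (γ z).swap) q.swap = Xsub X γ q := fun q => by
    ext z
    simp only [mem_Xsub, Prod.fst_swap, Prod.snd_swap]
    tauto
  obtain ⟨h1, h2, h3, h4, h5, h6⟩ := h
  refine ⟨h2, h1, by rwa [hX], h4, h5, ?_⟩
  rcases h6 with ⟨a, ha, hpa, hmin, hx⟩ | ⟨a, ha, hpa, hmin, hx⟩
  · exact Or.inr ⟨a, ha, hpa, hmin, by rw [← hX] at hx; exact hx⟩
  · exact Or.inl ⟨a, ha, hpa, hmin, by rw [← hX] at hx; exact hx⟩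

lemma ConflictAt.of_swap {X : Finset (Pt d)} {γ : Pt d → ℝ × ℝ} {p : ℝ × ℝ}
    {σ : Finset (Pt d)} {x : Pt d} (h : ConflictAt X (fun z => (γ z).swap) p σ x) :
    ConflictAt X γ p.swap σ x :=
  h.swap

/-- A conflict at `p` with the point `x` added in `p→` is part of a conflict triple as soon as some
point preceding `x` in the first order lies inside the circumsphere. -/
lemma exists_conflict_triple_of_lt {X : Finset (Pt d)} {γ : Pt d → ℝ × ℝ} {p : ℝ × ℝ}
    {σ : Finset (Pt d)} {x b c : Pt d} {r : ℝ}
    (hp1 : p.1 ∈ X.image fun z => (γ z).1) (hp2 : p.2 ∈ X.image fun z => (γ z).2)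
    (hσne : σ.Nonempty) (hσ : σ ⊆ Xsub X γ p) (hcard : σ.card = d + 1) (hr : 0 ≤ r)
    (hon : OnSphere c r σ) (hemp : SphEmpty c r (Xsub X γ p)) (hx : x ∈ X) (hxr : ‖x - c‖ < r)
    (hpx : p.1 < (γ x).1) (hsucc : ∀ b ∈ X.image (fun z => (γ z).1), p.1 < b → (γ x).1 ≤ b)
    (hxp : (γ x).2 ≤ p.2) (hb : b ∈ X) (hbr : ‖b - c‖ < r) (hbx : (γ b).1 < (γ x).1) :
    ∃ (y : Pt d) (q : ℝ × ℝ), x ≠ y ∧ ConflictAt X γ q σ x ∧ ConflictAt X γ q σ y := by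
  have hle : ∀ z ∈ X, (γ z).1 < (γ x).1 → (γ z).1 ≤ p.1 := fun z hz hzx => by
    by_contra! hlt
    exact absurd (hsucc _ (Finset.mem_image_of_mem _ hz) hlt) (not_le.mpr hzx)
  obtain ⟨y, hy, hmin⟩ := Finset.exists_min_image
    (X.filter fun z => ‖z - c‖ < r ∧ (γ z).1 < (γ x).1) (fun z => (γ z).2)
    ⟨b, Finset.mem_filter.mpr ⟨hb, hbr, hbx⟩⟩
  obtain ⟨hyX, hyr, hyx⟩ := Finset.mem_filter.mp hy
  have hpy : p.2 < (γ y).2 := by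
    by_contra! h
    exact hemp y (mem_Xsub.mpr ⟨hyX, hle y hyX hyx, h⟩) hyr
  obtain ⟨t, htA, hty, htsucc⟩ := exists_predecessor _ hp2 hpy
  have hpt : p.2 ≤ t := by
    by_contra! h
    exact absurd (htsucc _ hp2 h) (not_le.mpr hpy)
  have hdel : σ ∈ DelT (Xsub X γ (p.1, t)) := by
    refine ⟨hσne, fun z hz => ?_, c, r, hr, hon, fun z hz hzr => ?_⟩
    · obtain ⟨h1, h2, h3⟩ := mem_Xsub.mp (hσ hz)
      exact mem_Xsub.mpr ⟨h1, h2, h3.trans hpt⟩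
    · obtain ⟨h1, h2, h3⟩ := mem_Xsub.mp hz
      have := hmin z (Finset.mem_filter.mpr ⟨h1, hzr, h2.trans_lt hpx⟩)
      exact absurd (this.trans h3) (not_le.mpr hty)
  refine ⟨y, (p.1, t), fun h => hyx.ne (by rw [h]), ⟨hp1, htA, hdel, hcard, ⟨c, r, hr, hon, hxr⟩,
    Or.inl ⟨(γ x).1, Finset.mem_image_of_mem (fun z => (γ z).1) hx, hpx, hsucc, ?_⟩⟩,
    ⟨hp1, htA, hdel, hcard, ⟨c, r, hr, hon, hyr⟩,
    Or.inr ⟨(γ y).2, Finset.mem_image_of_mem (fun z => (γ z).2) hyX, hty, htsucc, ?_⟩⟩⟩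
  · exact mem_Xsub.mpr ⟨hx, le_rfl, hxp.trans hpt⟩
  · exact mem_Xsub.mpr ⟨hyX, hle y hyX hyx, le_rfl⟩

/-- Two distinct conflict pairs of `σ`, the first of which arises at some `p` by passing to `p→`,
yield a conflict triple containing the first one. -/
lemma exists_conflict_triple_of_right {X : Finset (Pt d)} {γ : Pt d → ℝ × ℝ} (hgen : GenPos X)
    (hinj1 : Set.InjOn (fun z => (γ z).1) (X : Set (Pt d)))
    (hinj2 : Set.InjOn (fun z => (γ z).2) (X : Set (Pt d)))
    {σ : Finset (Pt d)} {x z : Pt d} {p : ℝ × ℝ} (hxc : ConflictAt X γ p σ x)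
    (hright : ∃ a ∈ X.image (fun z => (γ z).1), p.1 < a ∧
      (∀ b ∈ X.image (fun z => (γ z).1), p.1 < b → a ≤ b) ∧ x ∈ Xsub X γ (a, p.2))
    (hz : ConflictPair X γ σ z) (hne : z ≠ x) :
    ∃ (y : Pt d) (q : ℝ × ℝ), x ≠ y ∧ ConflictAt X γ q σ x ∧ ConflictAt X γ q σ y := by
  obtain ⟨hp1, hp2, ⟨hσne, hσ, c, r, hr, hon, hemp⟩, hcard, ⟨c', r', _, hon', hxr⟩, -⟩ := hxc
  have hspan := hgen.affineSpan_eq_top (hσ.trans (Finset.filter_subset _ _)) hcard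
  obtain ⟨rfl, rfl⟩ := onSphere_unique hσne hspan hon hon'
  obtain ⟨a, -, hpa, hsucc, hxa⟩ := hright
  obtain ⟨hxX, hx1, hx2⟩ := mem_Xsub.mp hxa
  have hpx : p.1 < (γ x).1 := by
    by_contra! h
    exact hemp x (mem_Xsub.mpr ⟨hxX, h, hx2⟩) hxr
  obtain rfl : (γ x).1 = a :=
    le_antisymm hx1 (hsucc _ (Finset.mem_image_of_mem _ hxX) hpx)
  obtain ⟨q, hq1, hq2, ⟨-, hσq, c', r', _, hon', hempq⟩, -, ⟨c'', r'', _, hon'', hzr⟩, hzq⟩ := hz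
  obtain ⟨rfl, rfl⟩ := onSphere_unique hσne hspan hon hon'
  obtain ⟨rfl, rfl⟩ := onSphere_unique hσne hspan hon hon''
  have hzX : z ∈ X := by
    rcases hzq with ⟨_, _, _, _, h⟩ | ⟨_, _, _, _, h⟩ <;> exact (mem_Xsub.mp h).1
  by_cases hlt : (γ z).1 < (γ x).1
  · exact exists_conflict_triple_of_lt hp1 hp2 hσne hσ hcard hr hon hemp hxX hxr hpx hsucc hx2
      hzX hzr hlt
  have hgt : (γ x).1 < (γ z).1 :=
    lt_of_le_of_ne (not_lt.mp hlt) fun h => hne (hinj1 hzX hxX h.symm)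
  have hzx : q.2 < (γ x).2 ∧ (γ z).2 < (γ x).2 := by
    rcases hzq with ⟨a, -, hqa, ha, hza⟩ | ⟨a, -, hqa, ha, hza⟩
    · obtain ⟨-, hz1, hz2⟩ := mem_Xsub.mp hza
      have hxq : (γ x).1 ≤ q.1 := by
        by_contra! h
        exact absurd (ha _ (Finset.mem_image_of_mem _ hxX) h) (not_le.mpr (hgt.trans_le hz1))
      have : q.2 < (γ x).2 := by
        by_contra! h
        exact hempq x (mem_Xsub.mpr ⟨hxX, hxq, h⟩) hxr
      exact ⟨this, hz2.trans_lt this⟩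
    · obtain ⟨-, hz1, hz2⟩ := mem_Xsub.mp hza
      have : q.2 < (γ x).2 := by
        by_contra! h
        exact hempq x (mem_Xsub.mpr ⟨hxX, hgt.le.trans hz1, h⟩) hxr
      refine ⟨this, lt_of_le_of_ne (hz2.trans (ha _ (Finset.mem_image_of_mem _ hxX) this)) ?_⟩
      exact fun h => hne (hinj2 hzX hxX h)
  obtain ⟨t, htA, htx, htsucc⟩ := exists_predecessor _ hq2 hzx.1
  have hqt : q.2 ≤ t := by
    by_contra! h
    exact absurd (htsucc _ hq2 h) (not_le.mpr hzx.1)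
  obtain ⟨y, q', hxy, h1, h2⟩ := exists_conflict_triple_of_lt (γ := fun z => (γ z).swap)
    (p := (t, (γ x).1)) htA (Finset.mem_image_of_mem (fun z => (γ z).1) hxX) hσne
    (fun w hw => mem_Xsub.mpr ⟨(mem_Xsub.mp (hσ hw)).1, (mem_Xsub.mp (hσq hw)).2.2.trans hqt,
      (mem_Xsub.mp (hσ hw)).2.1.trans hpx.le⟩) hcard hr hon
    (fun w hw hwr => by
      obtain ⟨hwX, hw1, hw2⟩ := mem_Xsub.mp hw
      have hwx : (γ w).2 < (γ x).2 := lt_of_le_of_lt hw1 htx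
      have hwx1 : (γ w).1 < (γ x).1 := lt_of_le_of_ne hw2 fun h => by
        rw [hinj1 hwX hxX h] at hwx
        exact lt_irrefl _ hwx
      refine hemp w (mem_Xsub.mpr ⟨hwX, ?_, hwx.le.trans hx2⟩) hwr
      by_contra! h
      exact absurd (hsucc _ (Finset.mem_image_of_mem _ hwX) h) (not_le.mpr hwx1))
    hxX hxr htx htsucc le_rfl hzX hzr hzx.2
  exact ⟨y, q'.swap, hxy, h1.of_swap, h2.of_swap⟩

/-- A conflict pair is part of a conflict triple or is the only conflict pair of its simplex. -/
lemma ConflictAt.exists_triple_or_unique {X : Finset (Pt d)} {γ : Pt d → ℝ × ℝ}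
    (hgen : GenPos X) (hinj1 : Set.InjOn (fun z => (γ z).1) (X : Set (Pt d)))
    (hinj2 : Set.InjOn (fun z => (γ z).2) (X : Set (Pt d)))
    {σ : Finset (Pt d)} {x : Pt d} {p : ℝ × ℝ} (h : ConflictAt X γ p σ x) :
    (∃ (y : Pt d) (q : ℝ × ℝ), x ≠ y ∧ ConflictAt X γ q σ x ∧ ConflictAt X γ q σ y) ∨
      ∀ z, ConflictPair X γ σ z → z = x := by
  rw [or_iff_not_imp_right]
  intro hnot
  push Not at hnot
  obtain ⟨z, hz, hne⟩ := hnot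
  rcases h.2.2.2.2.2 with hr | hr
  · exact exists_conflict_triple_of_right hgen hinj1 hinj2 h hr hz hne
  · obtain ⟨a, ha, hpa, hmin, hxa⟩ := hr
    obtain ⟨hxX, hx1, hx2⟩ := mem_Xsub.mp hxa
    obtain ⟨q, hq⟩ := hz
    obtain ⟨y, q', hxy, h1, h2⟩ := exists_conflict_triple_of_right hgen hinj2 hinj1 h.swap
      ⟨a, ha, hpa, hmin, mem_Xsub.mpr ⟨hxX, hx2, hx1⟩⟩ ⟨q.swap, hq.swap⟩ hne
    exact ⟨y, q'.swap, hxy, h1.of_swap, h2.of_swap⟩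

/-- If `X` has the Δ-property and `|X| ≥ d+2`, then every `τ ∈ Incr(γ)` is a face
of a `(d+2)`-dimensional conflict simplex, or of a `(d+1)`-dimensional conflict simplex
`σ ∪ {x}` with `T_σ = {x}`. -/
theorem quasiPurity
    {d : ℕ} (hd : 1 ≤ d) (X : Finset (Pt d)) (γ : Pt d → ℝ × ℝ)
    (hgen : GenPos X)
    (hinj1 : Set.InjOn (fun z => (γ z).1) (↑X : Set (Pt d)))
    (hinj2 : Set.InjOn (fun z => (γ z).2) (↑X : Set (Pt d)))
    (Δ : Finset (Pt d)) (hΔ : IsDelta X γ Δ) (hcard : d + 2 ≤ X.card)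
    (τ : Finset (Pt d)) (hτ : τ ∈ Incr X γ) :
    (∃ σ : Finset (Pt d), ∃ x y : Pt d, ∃ p : ℝ × ℝ, x ≠ y ∧
        ConflictAt X γ p σ x ∧ ConflictAt X γ p σ y ∧ τ ⊆ insert x (insert y σ)) ∨
    (∃ σ : Finset (Pt d), ∃ x : Pt d, ConflictPair X γ σ x ∧
        (∀ z : Pt d, ConflictPair X γ σ z → z = x) ∧ τ ⊆ insert x σ) := by
  obtain ⟨hΔX, hΔcard, hΔlt, -, hhull⟩ := hΔ
  have hΔne : Δ.Nonempty := Finset.card_pos.mp (by omega)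
  obtain ⟨δ, hδ⟩ := hΔne
  -- It suffices to cover `τ` by a conflict pair or a conflict triple.
  have of_pair : ∀ σ x p, ConflictAt X γ p σ x → τ ⊆ insert x σ →
      (∃ σ : Finset (Pt d), ∃ x y : Pt d, ∃ p : ℝ × ℝ, x ≠ y ∧
        ConflictAt X γ p σ x ∧ ConflictAt X γ p σ y ∧ τ ⊆ insert x (insert y σ)) ∨
      (∃ σ : Finset (Pt d), ∃ x : Pt d, ConflictPair X γ σ x ∧
        (∀ z : Pt d, ConflictPair X γ σ z → z = x) ∧ τ ⊆ insert x σ) := by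
    intro σ x p h hsub
    rcases h.exists_triple_or_unique hgen hinj1 hinj2 with ⟨y, q, hxy, h1, h2⟩ | huniq
    · exact Or.inl ⟨σ, x, y, q, hxy, h1, h2,
        hsub.trans (Finset.insert_subset_insert _ (Finset.subset_insert _ _))⟩
    · exact Or.inr ⟨σ, x, ⟨p, h⟩, huniq, hsub⟩
  obtain ⟨-, hτX, x, y, c, r, ⟨hxτ, hxmax⟩, ⟨hyτ, hymax⟩, hr, hτon, hxr, hyr, hemp⟩ := hτ
  have hxX := hτX hxτ
  have hyX := hτX hyτ
  by_cases hτΔ : τ ⊆ Δ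
  · -- All of `τ` lies in `Δ`, which is in conflict with the first point outside of `Δ`.
    obtain ⟨z, hzX, hzΔ⟩ := Finset.exists_mem_notMem_of_card_lt_card
      (show Δ.card < X.card by omega)
    obtain ⟨b, hb, hbmin⟩ := Finset.exists_min_image (X \ Δ) (fun z => (γ z).1)
      ⟨z, Finset.mem_sdiff.mpr ⟨hzX, hzΔ⟩⟩
    obtain ⟨hbX, hbΔ⟩ := Finset.mem_sdiff.mp hb
    obtain ⟨σ, c', r', hr', hσΔ, hσcard, hon, hΔemp, -, hbr, -⟩ :=
      hgen.exists_circumsphere hΔX subset_rfl hΔcard hbX hbΔ hbΔ (hhull hbX) (c := b) le_rfl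
        (fun w _ _ => norm_nonneg _) (fun h => absurd h hbΔ) (by simp)
    obtain rfl : σ = Δ := Finset.eq_of_subset_of_card_le hσΔ (by omega)
    obtain ⟨t, htA, htb, htsucc⟩ := exists_predecessor (X.image fun z => (γ z).1)
      (Finset.mem_image_of_mem (fun z => (γ z).1) (hΔX hδ)) (hΔlt δ hδ b hbX hbΔ).1
    refine of_pair σ b (t, (γ b).2) ⟨htA, Finset.mem_image_of_mem (fun z => (γ z).2) hbX,
      ⟨⟨δ, hδ⟩, fun w hw => mem_Xsub.mpr ⟨hΔX hw, ?_, (hΔlt w hw b hbX hbΔ).2.le⟩, c', r', hr',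
        hon, fun w hw => ?_⟩, hσcard, ⟨c', r', hr', hon, hbr⟩,
      Or.inl ⟨_, Finset.mem_image_of_mem (fun z => (γ z).1) hbX, htb, htsucc,
        mem_Xsub.mpr ⟨hbX, le_rfl, le_rfl⟩⟩⟩ (hτΔ.trans (Finset.subset_insert _ _))
    · by_contra! h
      exact absurd (htsucc _ (Finset.mem_image_of_mem (fun z => (γ z).1) (hΔX hw)) h)
        (not_le.mpr (hΔlt w hw b hbX hbΔ).1)
    · obtain ⟨hwX, hw1, -⟩ := mem_Xsub.mp hw
      have hwΔ : w ∈ σ := by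
        by_contra h
        have := hbmin w (Finset.mem_sdiff.mpr ⟨hwX, h⟩)
        exact absurd (this.trans hw1) (not_le.mpr htb)
      exact (hon w hwΔ).not_lt
  obtain ⟨z, hzτ, hzΔ⟩ := Finset.not_subset.mp hτΔ
  have hxΔ : x ∉ Δ := fun h =>
    absurd (hΔlt x h z (hτX hzτ) hzΔ).1 (not_lt.mpr (hxmax z hzτ))
  have hyΔ : y ∉ Δ := fun h =>
    absurd (hΔlt y h z (hτX hzτ) hzΔ).2 (not_lt.mpr (hymax z hzτ))
  set W := (Xsub X γ ((γ x).1, (γ y).2)).erase x with hWdef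
  have hmemW : ∀ w, w ∈ W ↔ w ∈ X ∧ (γ w).1 < (γ x).1 ∧ (γ w).2 ≤ (γ y).2 := by
    intro w
    rw [hWdef, Finset.mem_erase, mem_Xsub]
    constructor
    · rintro ⟨hne, hwX, h1, h2⟩
      exact ⟨hwX, lt_of_le_of_ne h1 fun h => hne (hinj1 hwX hxX h), h2⟩
    · rintro ⟨hwX, h1, h2⟩
      exact ⟨fun h => h1.ne (by rw [h]), hwX, h1.le, h2⟩
  have hτW : ∀ w ∈ τ, w ≠ x → w ∈ W := fun w hw hwx =>
    Finset.mem_erase.mpr ⟨hwx, mem_Xsub.mpr ⟨hτX hw, hxmax w hw, hymax w hw⟩⟩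
  have hΔW : Δ ⊆ W := fun w hw => (hmemW w).mpr
    ⟨hΔX hw, (hΔlt w hw x hxX hxΔ).1, (hΔlt w hw y hyX hyΔ).2.le⟩
  obtain ⟨σ, c', r', hr', hσW, hσcard, hon, hWemp, hyin, hxin, hkeep⟩ :=
    hgen.exists_circumsphere (W := W) (fun w hw => ((hmemW w).mp hw).1) hΔW hΔcard hxX
      (Finset.notMem_erase _ _) hyΔ (hhull hxX) hr
      (fun w hw hwy => not_lt.mp (hemp w (Finset.mem_of_mem_erase hw)
        (Finset.ne_of_mem_erase hw) hwy)) (fun _ => hyr) hxr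
  have hσne : σ.Nonempty := Finset.card_pos.mp (by omega)
  have hτσ : ∀ w ∈ τ, w ≠ x → w ≠ y → w ∈ σ := fun w hw hwx hwy =>
    hkeep w (hτW w hw hwx) (hτon w hw hwx hwy)
  obtain ⟨s, hsA, hsx, hssucc⟩ := exists_predecessor (X.image fun z => (γ z).1)
    (Finset.mem_image_of_mem (fun z => (γ z).1) (hΔX hδ)) (hΔlt δ hδ x hxX hxΔ).1
  have hs : ∀ w ∈ X, (γ w).1 < (γ x).1 → (γ w).1 ≤ s := fun w hw hwx => by
    by_contra! h
    exact absurd (hssucc _ (Finset.mem_image_of_mem (fun z => (γ z).1) hw) h) (not_le.mpr hwx)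
  by_cases hy : y = x ∨ y ∈ σ
  · refine of_pair σ x (s, (γ y).2) ⟨hsA, Finset.mem_image_of_mem (fun z => (γ z).2) hyX,
      ⟨hσne, fun w hw => ?_, c', r', hr', hon, fun w hw => ?_⟩, hσcard, ⟨c', r', hr', hon, hxin⟩,
      Or.inl ⟨_, Finset.mem_image_of_mem (fun z => (γ z).1) hxX, hsx, hssucc,
        mem_Xsub.mpr ⟨hxX, le_rfl, hymax x hxτ⟩⟩⟩ fun w hw => ?_
    · obtain ⟨h1, h2, h3⟩ := (hmemW w).mp (hσW hw)
      exact mem_Xsub.mpr ⟨h1, hs w h1 h2, h3⟩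
    · obtain ⟨h1, h2, h3⟩ := mem_Xsub.mp hw
      by_cases hwy : w = y
      · subst hwy
        rcases hy with rfl | hy
        · exact absurd h2 (not_le.mpr hsx)
        · exact (hon w hy).not_lt
      · exact not_lt.mpr (hWemp w ((hmemW w).mpr ⟨h1, h2.trans_lt hsx, h3⟩) hwy)
    · rw [Finset.mem_insert, or_iff_not_imp_left]
      intro hwx
      by_cases hwy : w = y
      · subst hwy
        exact hy.resolve_left hwx
      · exact hτσ w hw hwx hwy
  · push Not at hy
    obtain ⟨hyx, hyσ⟩ := hy
    have hyr' := hyin (hτW y hyτ hyx) hyσ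
    obtain ⟨t, htA, hty, htsucc⟩ := exists_predecessor (X.image fun z => (γ z).2)
      (Finset.mem_image_of_mem (fun z => (γ z).2) (hΔX hδ)) (hΔlt δ hδ y hyX hyΔ).2
    have ht : ∀ w ∈ X, w ≠ y → (γ w).2 ≤ (γ y).2 → (γ w).2 ≤ t := fun w hw hwy hle => by
      by_contra! h
      have := htsucc _ (Finset.mem_image_of_mem (fun z => (γ z).2) hw) h
      exact hwy (hinj2 hw hyX (le_antisymm hle this))
    have hdel : σ ∈ DelT (Xsub X γ (s, t)) := by
      refine ⟨hσne, fun w hw => ?_, c', r', hr', hon, fun w hw => ?_⟩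
      · obtain ⟨h1, h2, h3⟩ := (hmemW w).mp (hσW hw)
        exact mem_Xsub.mpr ⟨h1, hs w h1 h2, ht w h1 (ne_of_mem_of_not_mem hw hyσ) h3⟩
      · obtain ⟨h1, h2, h3⟩ := mem_Xsub.mp hw
        refine not_lt.mpr (hWemp w ((hmemW w).mpr ⟨h1, h2.trans_lt hsx, h3.trans hty.le⟩) ?_)
        rintro rfl
        exact absurd h3 (not_le.mpr hty)
    refine Or.inl ⟨σ, x, y, (s, t), hyx.symm,
      ⟨hsA, htA, hdel, hσcard, ⟨c', r', hr', hon, hxin⟩,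
        Or.inl ⟨_, Finset.mem_image_of_mem (fun z => (γ z).1) hxX, hsx, hssucc,
          mem_Xsub.mpr ⟨hxX, le_rfl, ht x hxX hyx.symm (hymax x hxτ)⟩⟩⟩,
      ⟨hsA, htA, hdel, hσcard, ⟨c', r', hr', hon, hyr'⟩,
        Or.inr ⟨_, Finset.mem_image_of_mem (fun z => (γ z).2) hyX, hty, htsucc,
          mem_Xsub.mpr ⟨hyX, hs y hyX ((hmemW y).mp (hτW y hyτ hyx)).2.1, le_rfl⟩⟩⟩,
      fun w hw => ?_⟩
    rw [Finset.mem_insert, Finset.mem_insert]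
    by_cases hwx : w = x
    · exact Or.inl hwx
    by_cases hwy : w = y
    · exact Or.inr (Or.inl hwy)
    · exact Or.inr (Or.inr (hτσ w hw hwx hwy))
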